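/- Let T = C_1 C_2 ⋯ C_r be a tabloid of type B whose columns are admissible, and suppose the split form spl(T) = (lC_1)(rC_1)(lC_2)(rC_2)⋯(lC_r)(rC_r) is such that its reading is the highest weight vertex of its connected crystal component. Then T is an orthogonal tableau if and only if spl(T) is an orthogonal tableau. -/

import Mathlib

/-- Rank of a letter of the alphabet `B_n = {1 ≺ ⋯ ≺ n ≺ 0 ≺ n̄ ≺ ⋯ ≺ 1̄}`,
where the letter `i` is encoded by the integer `i`, `0` by `0` and `ī` by `-i`. -/
def rankB (n : ℕ) (v : ℤ) : ℤ :=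
  if 0 < v then v else if v = 0 then (n : ℤ) + 1 else 2 * (n : ℤ) + 2 + v

/-- `C` is a column of type `B`: letters of `B_n`, strictly increasing from top to
bottom except that the letter `0` may repeat. -/
def IsColB (n : ℕ) (C : List ℤ) : Prop :=
  (∀ v ∈ C, v.natAbs ≤ n) ∧
  C.Chain' (fun a b => rankB n a < rankB n b ∨ (a = 0 ∧ b = 0))

/-- Rank of a letter of `D_n`; the letters `n` and `n̄` share the same rank
(they are incomparable). -/
def rankD (n : ℕ) (v : ℤ) : ℤ :=
  if 0 < v then v else 2 * (n : ℤ) + v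

/-- `C` is a column of type `D`: letters of `D_n` with `x_{i+1} ⋠ x_i`. -/
def IsColD (n : ℕ) (C : List ℤ) : Prop :=
  (∀ v ∈ C, 1 ≤ v.natAbs ∧ v.natAbs ≤ n) ∧
  C.Chain' (fun a b => rankD n a ≤ rankD n b ∧ a ≠ b)

/-- `N(z)`: the number of letters `x` of `C` with `x ⪯ z` or `x ⪰ z̄`,
for an unbarred letter `z`; these are exactly the nonzero letters of absolute
value at most `z`. -/
def Ncount (n : ℕ) (C : List ℤ) (z : ℤ) : ℕ :=
  (C.filter (fun v => decide (v ≠ 0 ∧ (v.natAbs : ℤ) ≤ z))).length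

/-- Kashiwara–Nakashima admissibility: height at most `n` and `N(z) ≤ z` for
every pair `(z, z̄)` with `z ⪯ n` unbarred occurring in `C`. -/
def Admissible (n : ℕ) (C : List ℤ) : Prop :=
  C.length ≤ n ∧
  ∀ z : ℤ, 1 ≤ z → z ≤ (n : ℤ) → z ∈ C → -z ∈ C → (Ncount n C z : ℤ) ≤ z
/-- The multiset `I_C`: one letter `0` for each occurrence of `0` in `C` (listed
first), followed by the unbarred letters `z` with `(z, z̄)` occurring in `C`, in
decreasing order. -/
def IC (n : ℕ) (C : List ℤ) : List ℤ :=
  List.replicate (C.count 0) 0 ++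
    ((List.range n).reverse.filterMap fun k =>
      if ((k + 1 : ℤ) ∈ C ∧ (-((k : ℤ) + 1)) ∈ C) then some ((k : ℤ) + 1) else none)

/-- `GreedyJ n C I J bound` holds when `J` is the greedy choice of substitute
letters for `I`: each `t_i` is the greatest unbarred letter with
`t_i ≺ min (t_{i-1}, z_i)` such that neither `t_i` nor `t̄_i` occurs in `C`
(the letter `0` is treated as larger than every unbarred letter). -/
def GreedyJ (n : ℕ) (C : List ℤ) : List ℤ → List ℤ → ℤ → Prop
  | [], [], _ => True
  | z :: I, t :: J, bound =>
      (1 ≤ t ∧ t < min bound (if z = 0 then (n : ℤ) + 1 else z) ∧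
        t ∉ C ∧ -t ∉ C ∧
        (∀ t' : ℤ, t < t' → t' < min bound (if z = 0 then (n : ℤ) + 1 else z) →
          t' ∈ C ∨ -t' ∈ C)) ∧
      GreedyJ n C I J t
  | _, _, _ => False

/-- A column of type `B` can be split when the greedy choice of the `t_i`
succeeds. -/
def CanSplitB (n : ℕ) (C : List ℤ) : Prop :=
  ∃ J : List ℤ, GreedyJ n C (IC n C) J ((n : ℤ) + 1)

/-- The type-`B` column `Ĉ` associated to a column of type `D`: each factor
`n̄ n` is replaced by `0 0`. -/
def hatD (n : ℕ) : List ℤ → List ℤ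
  | [] => []
  | [a] => [a]
  | a :: b :: rest =>
      if a = -(n : ℤ) ∧ b = (n : ℤ) then 0 :: 0 :: hatD n rest
      else a :: hatD n (b :: rest)

/-- `(lC, rC)` is the split pair of the column `C`: in `rC` each `z̄_i` is
changed into `t̄_i` and in `lC` each `z_i` is changed into `t_i`, reordering
afterwards. -/
def SplitPair (n : ℕ) (C l r : List ℤ) : Prop :=
  ∃ J : List ℤ, GreedyJ n C (IC n C) J ((n : ℤ) + 1) ∧
    l.Chain' (fun a b => rankB n a < rankB n b) ∧
    (l : Multiset ℤ) + (IC n C : Multiset ℤ) = (C : Multiset ℤ) + (J : Multiset ℤ) ∧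
    r.Chain' (fun a b => rankB n a < rankB n b) ∧
    (r : Multiset ℤ) + (((IC n C).map fun z => -z : List ℤ) : Multiset ℤ)
      = (C : Multiset ℤ) + (((J.map fun z => -z : List ℤ)) : Multiset ℤ)
/-- Crystal operator `ẽ_i` on the vector crystal of `U_q(so_{2n+1})`:
`1 →¹ 2 → ⋯ → n →ⁿ 0 →ⁿ n̄ → ⋯ →¹ 1̄` (indices `1 ≤ i ≤ n`). -/
def vE (n i : ℕ) (x : ℤ) : Option ℤ :=
  if i < n then
    if x = (i : ℤ) + 1 then some (i : ℤ)
    else if x = -(i : ℤ) then some (-((i : ℤ) + 1)) else none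
  else
    if x = 0 then some (n : ℤ) else if x = -(n : ℤ) then some 0 else none

/-- Crystal operator `f̃_i` on the vector crystal of type `B`. -/
def vF (n i : ℕ) (x : ℤ) : Option ℤ :=
  if i < n then
    if x = (i : ℤ) then some ((i : ℤ) + 1)
    else if x = -((i : ℤ) + 1) then some (-(i : ℤ)) else none
  else
    if x = (n : ℤ) then some 0 else if x = 0 then some (-(n : ℤ)) else none

/-- `ε_i` on the vector crystal of type `B`. -/
def vEps (n i : ℕ) (x : ℤ) : ℕ :=
  if i < n then (if x = (i : ℤ) + 1 ∨ x = -(i : ℤ) then 1 else 0)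
  else (if x = 0 then 1 else if x = -(n : ℤ) then 2 else 0)

/-- `φ_i` on the vector crystal of type `B`. -/
def vPhi (n i : ℕ) (x : ℤ) : ℕ :=
  if i < n then (if x = (i : ℤ) ∨ x = -((i : ℤ) + 1) then 1 else 0)
  else (if x = (n : ℤ) then 2 else if x = 0 then 1 else 0)

/-- `ε_i` of a word `x₁ ⋯ x_l`, viewed as `x₁ ⊗ ⋯ ⊗ x_l`, via the tensor rule. -/
def wEps (n i : ℕ) : List ℤ → ℕ
  | [] => 0
  | x :: w => if vPhi n i x < wEps n i w then wEps n i w + vEps n i x - vPhi n i x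
              else vEps n i x

/-- `φ_i` of a word via the tensor rule. -/
def wPhi (n i : ℕ) : List ℤ → ℕ
  | [] => 0
  | x :: w => if wEps n i w < vPhi n i x then wPhi n i w + vPhi n i x - wEps n i w
              else wPhi n i w

/-- `f̃_i` on words (the crystal `G_n^B` of `⊕_l (V_n^B)^{⊗l}`). -/
def wF (n i : ℕ) : List ℤ → Option (List ℤ)
  | [] => none
  | x :: w => if wEps n i w < vPhi n i x then (vF n i x).map (· :: w)
              else (wF n i w).map (x :: ·)

/-- `ẽ_i` on words. -/
def wE (n i : ℕ) : List ℤ → Option (List ℤ)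
  | [] => none
  | x :: w => if vPhi n i x < wEps n i w then (wE n i w).map (x :: ·)
              else (vE n i x).map (· :: w)

/-- A word is a highest weight vertex when it is killed by all `ẽ_i`. -/
def HighestWt (n : ℕ) (w : List ℤ) : Prop :=
  ∀ i : ℕ, 1 ≤ i → i ≤ n → wE n i w = none

/-- Apply a sequence of lowering operators `f̃_{i₁}, …, f̃_{i_r}` to a word. -/
def applyF (n : ℕ) : List ℕ → List ℤ → Option (List ℤ)
  | [], w => some w
  | i :: F, w => (wF n i w).bind (applyF n F)

/-- Two words occur at the same place in two isomorphic connected components of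
the crystal of words: they are obtained from highest weight vertices by the
same sequence of lowering operators. -/
def SamePlace (n : ℕ) (w₁ w₂ : List ℤ) : Prop :=
  ∃ h₁ h₂ : List ℤ, ∃ F : List ℕ, HighestWt n h₁ ∧ HighestWt n h₂ ∧
    applyF n F h₁ = some w₁ ∧ applyF n F h₂ = some w₂

/-- Two words lie in the same connected component of the crystal of words. -/
def Conn (n : ℕ) : List ℤ → List ℤ → Prop :=
  Relation.EqvGen (fun a b => ∃ i : ℕ, 1 ≤ i ∧ i ≤ n ∧ wF n i a = some b)

/-- The reading of a tabloid `T = C₁ ⋯ C_r` is `w(C_r) ⋯ w(C₁)`. -/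
def readT (T : List (List ℤ)) : List ℤ := T.reverse.flatten

/-- A tabloid of type `B`: a filling of a Young diagram whose columns (given
from left to right, each read from top to bottom) are columns of type `B`. -/
def IsTabloidB (n : ℕ) (T : List (List ℤ)) : Prop :=
  (∀ C ∈ T, IsColB n C ∧ C ≠ []) ∧
  T.Chain' (fun a b => b.length ≤ a.length)

/-- The reading of the canonical (highest weight) tableau whose columns have
the given heights: the column of height `h` is `1 2 ⋯ h`. -/
def canonWord (hs : List ℕ) : List ℤ :=
  (hs.map fun h => (List.range h).map fun j => (j : ℤ) + 1).reverse.flatten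

/-- An orthogonal tableau of type `B`: a tabloid whose reading lies in the
connected component `B(v_λ)` of the canonical highest weight vertex of its
shape. -/
def IsOrthTabB (n : ℕ) (T : List (List ℤ)) : Prop :=
  IsTabloidB n T ∧ Conn n (readT T) (canonWord (T.map List.length))

/-! ### Auxiliary type `A` crystal of words -/

/-- Value of the simple coroot `h_j` on a letter `k` (`true`) or `k^*` (`false`). -/
def aH (j : ℤ) (y : ℤ × Bool) : ℤ :=
  (if y.2 then 1 else -1) * ((if y.1 = j then 1 else 0) - (if y.1 = j + 1 then 1 else 0))

/-- `ε_j` on type `A` words. -/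
def aEps (j : ℤ) : List (ℤ × Bool) → ℤ
  | [] => 0
  | y :: w => max (max 0 (-(aH j y))) (aEps j w - aH j y)

/-- `f_j` on letters. -/
def aFl (j : ℤ) (y : ℤ × Bool) : ℤ × Bool := if y.2 then (j + 1, true) else (j, false)

/-- `f_j` on type `A` words, as a relation. -/
inductive AF (j : ℤ) : List (ℤ × Bool) → List (ℤ × Bool) → Prop
  | here (y u) : aH j y = 1 → aEps j u = 0 → AF j (y :: u) (aFl j y :: u)
  | there (y u u') : max 0 (aH j y) ≤ aEps j u → AF j u u' → AF j (y :: u) (y :: u')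

/-- Pairing of a letter with the indicator vector of a subset given by its counting function. -/
def pr (P : ℤ → ℤ) (y : ℤ × Bool) : ℤ :=
  (if y.2 then 1 else -1) * (P y.1 - P (y.1 - 1))

/-- Counting functions of `k`-subsets of `{1,…,N}`. -/
def Ad (N k : ℤ) (P : ℤ → ℤ) : Prop :=
  P 0 = 0 ∧ P N = k ∧ ∀ j, 0 ≤ P j - P (j - 1) ∧ P j - P (j - 1) ≤ 1

/-- Pairing with the simple root `α_j`. -/
def cc (j : ℤ) (P : ℤ → ℤ) : ℤ := 2 * P j - P (j - 1) - P (j + 1)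

/-- Simple reflection. -/
def ss (j : ℤ) (P : ℤ → ℤ) : ℤ → ℤ := fun t => if t = j then P j - cc j P else P t

/-- Chains of subsets with total pairing at least `M`. -/
def Ch (N k : ℤ) : (ℤ → ℤ) → List (ℤ × Bool) → ℤ → Prop
  | _, [], M => M ≤ 0
  | b, y :: w, M => ∃ a, Ad N k a ∧ b ≤ a ∧ Ch N k a w (M - pr a y)

theorem aEps_nonneg (j : ℤ) (w) : 0 ≤ aEps j w := by
  cases w with
  | nil => simp [aEps]
  | cons y w => simp [aEps]

theorem aH_cases (j : ℤ) (y) : aH j y = -1 ∨ aH j y = 0 ∨ aH j y = 1 := by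
  unfold aH; split_ifs <;> omega

theorem Ch_mono {N k : ℤ} {w} : ∀ {b b' : ℤ → ℤ} {M M' : ℤ}, Ch N k b w M → b' ≤ b → M' ≤ M →
    Ch N k b' w M' := by
  induction w with
  | nil => intro b b' M M' h _ h2; simp only [Ch] at *; omega
  | cons y w ih =>
    intro b b' M M' h h1 h2
    obtain ⟨a, ha, hb, hc⟩ := h
    exact ⟨a, ha, h1.trans hb, ih hc le_rfl (by omega)⟩

theorem pr_aFl {j : ℤ} {y} (h : aH j y = 1) (P) : pr P (aFl j y) = pr P y - cc j P := by
  obtain ⟨k, s⟩ := y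
  cases s <;> simp only [aH, aFl, pr, cc] at * <;> simp at *
  · have : k = j + 1 := by split_ifs at h <;> omega
    subst this; ring_nf
  · have : k = j := by split_ifs at h <;> omega
    subst this; ring_nf

theorem aH_aFl {j : ℤ} {y} (h : aH j y = 1) : aH j (aFl j y) = -1 := by
  obtain ⟨k, s⟩ := y
  cases s <;> simp [aH, aFl]

theorem pr_ss (j : ℤ) (P) (y) : pr (ss j P) y = pr P y - cc j P * aH j y := by
  obtain ⟨k, s⟩ := y
  by_cases h1 : k = j
  · subst h1
    cases s <;> simp [aH, pr, ss] <;> ring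
  · by_cases h2 : k = j + 1
    · subst h2
      cases s <;> simp [aH, pr, ss] <;> ring
    · have : k - 1 ≠ j := by omega
      cases s <;> simp [aH, pr, ss, h1, h2, this]

theorem cc_cases {N k : ℤ} {P} (h : Ad N k P) (j : ℤ) : cc j P = -1 ∨ cc j P = 0 ∨ cc j P = 1 := by
  have h1 := h.2.2 j
  have h2 := h.2.2 (j + 1)
  simp only [add_sub_cancel_right] at h2
  unfold cc; omega

theorem Ad_ss {N k : ℤ} {P} (h : Ad N k P) {j : ℤ} (h0 : 0 < j) (hN : j < N) : Ad N k (ss j P) := by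
  refine ⟨?_, ?_, fun t => ?_⟩
  · simp [ss, h.1, h0.ne]
  · simp [ss, h.2.1, hN.ne']
  · have h1 := h.2.2 j
    have h2 := h.2.2 (j + 1)
    simp only [add_sub_cancel_right] at h2
    by_cases e1 : t = j
    · subst e1
      simp [ss, cc]; omega
    · by_cases e2 : t = j + 1
      · subst e2
        simp [ss, cc]; omega
      · have : t - 1 ≠ j := by omega
        simpa [ss, e1, this] using h.2.2 t

theorem le_ss_of {b a : ℤ → ℤ} {j : ℤ} (h : b ≤ a) (hb : cc j b ≤ 0) (ha : cc j a = 1) :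
    b ≤ ss j a := by
  intro t
  by_cases e : t = j
  · subst e
    have h0 := h t; have h1 := h (t - 1); have h2 := h (t + 1)
    simp only [ss, if_true, cc] at *; omega
  · simpa [ss, e] using h t

theorem ss_le_of {b a : ℤ → ℤ} {j : ℤ} (h : b ≤ a) (hb : cc j b = -1) (ha : 0 ≤ cc j a) :
    ss j b ≤ a := by
  intro t
  by_cases e : t = j
  · subst e
    have h0 := h t; have h1 := h (t - 1); have h2 := h (t + 1)
    simp only [ss, if_true, cc] at *; omega
  · simpa [ss, e] using h t

theorem ss_le_ss {b a : ℤ → ℤ} {j : ℤ} (h : b ≤ a) (hc : cc j b = cc j a) :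
    ss j b ≤ ss j a := by
  intro t
  by_cases e : t = j
  · subst e
    have h1 : b t ≤ a t := h t
    simp only [ss, if_true]; omega
  · simpa [ss, e] using h t

theorem ss_le {a : ℤ → ℤ} {j : ℤ} (h : 0 ≤ cc j a) : ss j a ≤ a := by
  intro t
  by_cases e : t = j
  · subst e
    simp only [ss, if_true] at *; omega
  · simp [ss, e]

theorem le_ss {a : ℤ → ℤ} {j : ℤ} (h : cc j a ≤ 0) : a ≤ ss j a := by
  intro t
  by_cases e : t = j
  · subst e
    simp only [ss, if_true] at *; omega
  · simp [ss, e]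

/-- Lowering preserves the existence of chains. -/
theorem Ch_down {N k j : ℤ} (h0 : 0 < j) (hN : j < N) {w w'} (hw : AF j w w') :
    ∀ (b : ℤ → ℤ) (M : ℤ), Ch N k b w M →
      (cc j b ≤ 0 → Ch N k b w' M) ∧
      (cc j b = 1 → Ch N k b w' M ∨ Ch N k (ss j b) w' (M + aEps j w)) := by
  induction hw with
  | here y u hy hu =>
    rintro b M ⟨a, ha, hab, hc⟩
    have e0 : aEps j (y :: u) = 0 := by simp [aEps, hy, hu]
    by_cases hca : cc j a ≤ 0
    · have : Ch N k b (aFl j y :: u) M :=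
        ⟨a, ha, hab, Ch_mono hc le_rfl (by rw [pr_aFl hy]; omega)⟩
      exact ⟨fun _ => this, fun _ => Or.inl this⟩
    · have hc1 : cc j a = 1 := by have := cc_cases ha j; omega
      have key : Ch N k (ss j a) u (M - pr (ss j a) (aFl j y)) :=
        Ch_mono hc (ss_le (by omega)) (by rw [pr_ss, aH_aFl hy, pr_aFl hy, hc1]; omega)
      refine ⟨fun hb => ⟨ss j a, Ad_ss ha h0 hN, le_ss_of hab hb hc1, key⟩,
        fun hb => Or.inr ?_⟩
      rw [e0, add_zero]
      exact ⟨ss j a, Ad_ss ha h0 hN, ss_le_ss hab (hb.trans hc1.symm), key⟩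
  | there y u u' hy hu ih =>
    rintro b M ⟨a, ha, hab, hc⟩
    have e0 : aEps j (y :: u) = aEps j u - aH j y := by
      have := aEps_nonneg j u
      simp only [aEps]; omega
    have e1 := aEps_nonneg j (y :: u)
    obtain ⟨i1, i2⟩ := ih a _ hc
    by_cases hca : cc j a ≤ 0
    · have : Ch N k b (y :: u') M := ⟨a, ha, hab, i1 hca⟩
      exact ⟨fun _ => this, fun _ => Or.inl this⟩
    · have hc1 : cc j a = 1 := by have := cc_cases ha j; omega
      rcases i2 hc1 with i2 | i2
      · have : Ch N k b (y :: u') M := ⟨a, ha, hab, i2⟩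
        exact ⟨fun _ => this, fun _ => Or.inl this⟩
      · refine ⟨fun hb => ⟨ss j a, Ad_ss ha h0 hN, le_ss_of hab hb hc1, ?_⟩, fun hb =>
          Or.inr ⟨ss j a, Ad_ss ha h0 hN, ss_le_ss hab (hb.trans hc1.symm), ?_⟩⟩
        · exact Ch_mono i2 le_rfl (by rw [pr_ss, hc1]; omega)
        · exact Ch_mono i2 le_rfl (by rw [pr_ss, hc1]; omega)

theorem Ch_raise {N k j : ℤ} (h0 : 0 < j) (hN : j < N) {w} :
    ∀ (a : ℤ → ℤ) (M : ℤ), cc j a = -1 → Ch N k a w M → Ch N k (ss j a) w (M - aEps j w) := by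
  induction w with
  | nil => intro a M _ h; simpa [Ch, aEps] using h
  | cons y v ih =>
    rintro a M hca ⟨d, hd, had, hc⟩
    have e0 : aEps j v - aH j y ≤ aEps j (y :: v) := by simp [aEps]
    have e1 := aEps_nonneg j (y :: v)
    by_cases hcd : 0 ≤ cc j d
    · exact ⟨d, hd, ss_le_of had hca hcd, Ch_mono hc le_rfl (by omega)⟩
    · have hc1 : cc j d = -1 := by have := cc_cases hd j; omega
      exact ⟨ss j d, Ad_ss hd h0 hN, ss_le_ss had (hca.trans hc1.symm),
        Ch_mono (ih d _ hc1 hc) le_rfl (by rw [pr_ss, hc1]; omega)⟩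

theorem Ch_up {N k j : ℤ} (h0 : 0 < j) (hN : j < N) {w w'} (hw : AF j w w') :
    ∀ (b : ℤ → ℤ) (M : ℤ), Ch N k b w' M → Ch N k b w M := by
  induction hw with
  | here y u hy hu =>
    rintro b M ⟨a, ha, hab, hc⟩
    rw [pr_aFl hy] at hc
    by_cases hca : 0 ≤ cc j a
    · exact ⟨a, ha, hab, Ch_mono hc le_rfl (by omega)⟩
    · have hc1 : cc j a = -1 := by have := cc_cases ha j; omega
      exact ⟨ss j a, Ad_ss ha h0 hN, hab.trans (le_ss (by omega)),
        Ch_mono (Ch_raise h0 hN a _ hc1 hc) le_rfl (by rw [pr_ss, hc1, hy, hu]; omega)⟩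
  | there y u u' hy hu ih =>
    rintro b M ⟨a, ha, hab, hc⟩
    exact ⟨a, ha, hab, ih a _ hc⟩

theorem Ch_iff {N k j : ℤ} (h0 : 0 < j) (hN : j < N) {w w'} (hw : AF j w w') (M : ℤ) :
    Ch N k 0 w M ↔ Ch N k 0 w' M :=
  ⟨fun h => (Ch_down h0 hN hw 0 M h).1 (by simp [cc]), Ch_up h0 hN hw 0 M⟩

/-- The top subset `{1,…,k}`. -/
def topP (N k : ℤ) : ℤ → ℤ := fun t => if t ≤ 0 then 0 else if t ≤ k then t else k

theorem Ad_topP {N k : ℤ} (hk : 0 ≤ k) (hN : k ≤ N) : Ad N k (topP N k) := by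
  refine ⟨by simp [topP], ?_, fun j => ?_⟩ <;> simp only [topP] <;> split_ifs <;> omega

/-- Total pairing of a word with a vector. -/
def prs (P : ℤ → ℤ) (w : List (ℤ × Bool)) : ℤ := (w.map (pr P)).sum

theorem Ch_const {N k : ℤ} {P} (h : Ad N k P) (w) : Ch N k P w (prs P w) := by
  induction w with
  | nil => simp [Ch, prs]
  | cons y w ih => exact ⟨P, h, le_rfl, by simpa [prs] using ih⟩

theorem Ad_nonneg {N k : ℤ} {P} (h : Ad N k P) (m : ℕ) : 0 ≤ P m := by
  induction m with
  | zero => simp [h.1]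
  | succ m ih =>
    have := h.2.2 (m + 1)
    simp only [add_sub_cancel_right] at this
    push_cast; omega

theorem Ad_le_top {N k : ℤ} {P} (h : Ad N k P) {t : ℤ} (h0 : 0 ≤ t) (hN : t ≤ N) :
    P t ≤ topP N k t := by
  have a1 : ∀ m : ℕ, P m ≤ m := by
    intro m
    induction m with
    | zero => simp [h.1]
    | succ m ih =>
      have := h.2.2 (m + 1)
      simp only [add_sub_cancel_right] at this
      push_cast; omega
  have a2 : ∀ m : ℕ, P (N - m) ≤ k := by
    intro m
    induction m with
    | zero => simp [h.2.1]
    | succ m ih =>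
      have := h.2.2 (N - m)
      push_cast
      rw [show N - ((m:ℤ) + 1) = N - m - 1 by ring]; omega
  have b1 := a1 t.toNat
  have b2 := a2 (N - t).toNat
  rw [Int.toNat_of_nonneg h0] at b1
  rw [Int.toNat_of_nonneg (by omega), sub_sub_cancel] at b2
  simp only [topP]; split_ifs <;> omega

theorem pr_sum {N : ℤ} {d : ℤ → ℤ} (h0 : d 0 = 0) (hN : d N = 0) {y : ℤ × Bool}
    (h1 : 1 ≤ y.1) (h2 : y.1 ≤ N) :
    pr d y = ∑ j ∈ Finset.Ioo 0 N, aH j y * d j := by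
  obtain ⟨k, s⟩ := y
  simp only at h1 h2
  have e1 : ∑ j ∈ Finset.Ioo 0 N, (if k = j then 1 else 0) * d j = d k := by
    simp only [ite_mul, one_mul, zero_mul, Finset.sum_ite_eq, Finset.mem_Ioo]
    split_ifs with h
    · rfl
    · have : k = N := by omega
      rw [this, hN]
  have e2 : ∑ j ∈ Finset.Ioo 0 N, (if k = j + 1 then 1 else 0) * d j = d (k - 1) := by
    have : ∀ j, (k = j + 1) = (k - 1 = j) := fun j => by apply propext; omega
    simp only [this, ite_mul, one_mul, zero_mul, Finset.sum_ite_eq, Finset.mem_Ioo]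
    split_ifs with h
    · rfl
    · have : k - 1 = 0 := by omega
      rw [this, h0]
  simp only [pr, aH, mul_assoc, ← Finset.mul_sum, sub_mul, Finset.sum_sub_distrib, e1, e2]

theorem Ch_bound {N k : ℤ} (hk : 0 ≤ k) (hkN : k ≤ N) {w : List (ℤ × Bool)}
    (hw : ∀ y ∈ w, 1 ≤ y.1 ∧ y.1 ≤ N) :
    ∀ (b : ℤ → ℤ) (M : ℤ), (∀ t, 0 < t → t < N → b t ≤ topP N k t) → Ch N k b w M →
      M ≤ prs (topP N k) w + ∑ j ∈ Finset.Ioo 0 N, aEps j w * (topP N k j - b j) := by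
  induction w with
  | nil => intro b M _ h; simpa [Ch, prs, aEps] using h
  | cons y w ih =>
    rintro b M hb ⟨a, ha, hab, hc⟩
    have ht := Ad_topP hk hkN
    have := ih (fun z hz => hw z (List.mem_cons_of_mem _ hz)) a _
      (fun t h1 h2 => Ad_le_top ha h1.le h2.le) hc
    have hy := hw y (List.mem_cons_self ..)
    have e := pr_sum (N := N) (d := fun j => topP N k j - a j) (by simp [ht.1, ha.1])
      (by simp [ht.2.1, ha.2.1]) hy.1 hy.2
    have e' : pr (fun j => topP N k j - a j) y = pr (topP N k) y - pr a y := by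
      simp only [pr]; ring
    have : ∑ j ∈ Finset.Ioo 0 N, (aEps j w * (topP N k j - a j) - aH j y * (topP N k j - a j))
        ≤ ∑ j ∈ Finset.Ioo 0 N, aEps j (y :: w) * (topP N k j - b j) := by
      apply Finset.sum_le_sum
      intro j hj
      rw [Finset.mem_Ioo] at hj
      have f1 : aEps j w - aH j y ≤ aEps j (y :: w) := by simp [aEps]
      have f2 := aEps_nonneg j (y :: w)
      have f3 := Ad_le_top ha hj.1.le hj.2.le
      have f4 := hab j
      nlinarith
    rw [Finset.sum_sub_distrib] at this
    simp only [prs, List.map_cons, List.sum_cons] at *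
    omega

/-- On highest weight words chains are bounded by the weight. -/
theorem Ch_hw {N k : ℤ} (hk : 0 ≤ k) (hkN : k ≤ N) {w : List (ℤ × Bool)}
    (hw : ∀ y ∈ w, 1 ≤ y.1 ∧ y.1 ≤ N) (he : ∀ j, 0 < j → j < N → aEps j w = 0) {M : ℤ}
    (h : Ch N k 0 w M) : M ≤ prs (topP N k) w := by
  have := Ch_bound hk hkN hw 0 M (fun t h1 h2 => by simp only [topP, Pi.zero_apply]; split_ifs <;> omega) h
  rw [Finset.sum_eq_zero] at this
  · simpa using this
  · intro j hj
    rw [Finset.mem_Ioo] at hj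
    rw [he j hj.1 hj.2, zero_mul]

/-! ### Virtualization of type `B` words -/

/-- Image of a letter of `B_n` in the type `A_{2n-1}` crystal. -/
def vl (n : ℕ) (x : ℤ) : List (ℤ × Bool) :=
  if 1 ≤ x ∧ x ≤ n then [(x, true), (2 * n + 1 - x, false)]
  else if x = 0 then [((n : ℤ) + 1, true), ((n : ℤ) + 1, false)]
  else if -(n : ℤ) ≤ x ∧ x ≤ -1 then [(2 * n + 1 + x, true), (-x, false)]
  else []

/-- Image of a word. -/
def virt (n : ℕ) : List ℤ → List (ℤ × Bool)
  | [] => []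
  | x :: w => vl n x ++ virt n w

/-- Integer form of the coroot value. -/
def zh (n i : ℕ) (x : ℤ) : ℤ := (vPhi n i x : ℤ) - vEps n i x

theorem wEps_cons (n i : ℕ) (x : ℤ) (w : List ℤ) :
    (wEps n i (x :: w) : ℤ) = max (vEps n i x : ℤ) (wEps n i w - zh n i x) := by
  simp only [wEps, zh]; split_ifs <;> omega

theorem aH_t (j k : ℤ) :
    aH j (k, true) = (if k = j then 1 else 0) - (if k = j + 1 then 1 else 0) := by simp [aH]

theorem aH_f (j k : ℤ) :
    aH j (k, false) = (if k = j + 1 then 1 else 0) - (if k = j then 1 else 0) := by simp [aH]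

theorem vl_pos {n : ℕ} {x : ℤ} (h : 1 ≤ x ∧ x ≤ n) :
    vl n x = [(x, true), (2 * n + 1 - x, false)] := by rw [vl, if_pos h]

theorem vl_zero {n : ℕ} : vl n 0 = [((n : ℤ) + 1, true), ((n : ℤ) + 1, false)] := by
  rw [vl, if_neg (by omega), if_pos rfl]

theorem vl_neg {n : ℕ} {x : ℤ} (h : -(n : ℤ) ≤ x ∧ x ≤ -1) :
    vl n x = [(2 * n + 1 + x, true), (-x, false)] := by
  rw [vl, if_neg (by omega), if_neg (by omega), if_pos h]

theorem vl_out {n : ℕ} {x : ℤ} (h : x < -(n : ℤ) ∨ n < x) : vl n x = [] := by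
  rw [vl, if_neg (by omega), if_neg (by omega), if_neg (by omega)]

theorem x_cases (n : ℕ) (x : ℤ) : (1 ≤ x ∧ x ≤ n) ∨ x = 0 ∨ (-(n : ℤ) ≤ x ∧ x ≤ -1) ∨
    (x < -(n : ℤ) ∨ n < x) := by omega

/-- `h_j` on the two letters of the image, for `j = i` or `j = 2n - i`. -/
theorem vl_eps {n i : ℕ} (h1 : 1 ≤ i) (hi : i ≤ n) {j : ℤ} (hj : j = i ∨ j = 2 * n - i)
    (x : ℤ) (u : List (ℤ × Bool)) :
    aEps j (vl n x ++ u) = max (vEps n i x : ℤ) (aEps j u - zh n i x) := by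
  have hu := aEps_nonneg j u
  rcases x_cases n x with c | c | c | c
  · rw [vl_pos c]
    simp only [List.cons_append, List.nil_append, aEps, aH_t, aH_f, zh, vPhi, vEps]
    generalize aEps j u = e at *
    rcases hj with rfl | rfl <;> rcases hi.lt_or_eq with hi | rfl <;>
      simp only [hi, if_true, lt_irrefl, if_false] <;> split_ifs <;> omega
  · subst c; rw [vl_zero]
    simp only [List.cons_append, List.nil_append, aEps, aH_t, aH_f, zh, vPhi, vEps]
    generalize aEps j u = e at *
    rcases hj with rfl | rfl <;> rcases hi.lt_or_eq with hi | rfl <;>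
      simp only [hi, if_true, lt_irrefl, if_false] <;> split_ifs <;> omega
  · rw [vl_neg c]
    simp only [List.cons_append, List.nil_append, aEps, aH_t, aH_f, zh, vPhi, vEps]
    generalize aEps j u = e at *
    rcases hj with rfl | rfl <;> rcases hi.lt_or_eq with hi | rfl <;>
      simp only [hi, if_true, lt_irrefl, if_false] <;> split_ifs <;> omega
  · rw [vl_out c]
    simp only [List.nil_append, zh, vPhi, vEps]
    split_ifs <;> omega

theorem virt_eps {n i : ℕ} (h1 : 1 ≤ i) (hi : i ≤ n) {j : ℤ} (hj : j = i ∨ j = 2 * n - i)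
    (w : List ℤ) : aEps j (virt n w) = wEps n i w := by
  induction w with
  | nil => simp [virt, aEps, wEps]
  | cons x w ih => rw [virt, vl_eps h1 hi hj, wEps_cons, ih]

/-- Non-adjacent operators do not change `ε`. -/
theorem AF_far {i j : ℤ} (h : i + 2 ≤ j) {W Z} (hW : AF i W Z) : aEps j Z = aEps j W := by
  induction hW with
  | here y u hy hu =>
    have : aH j (aFl i y) = aH j y := by
      obtain ⟨k, s⟩ := y
      cases s <;> simp only [aH, aFl] at * <;> simp at *
      · have : k = i + 1 := by split_ifs at hy <;> omega
        subst this; split_ifs <;> omega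
      · have : k = i := by split_ifs at hy <;> omega
        subst this; split_ifs <;> omega
    simp only [aEps, this]
  | there y u u' hy hu ih => simp only [aEps, ih]

theorem AF_vl {n i : ℕ} (h1 : 1 ≤ i) (hi : i ≤ n) {j : ℤ} (hj : j = i ∨ j = 2 * n - i)
    (x : ℤ) {u u' : List (ℤ × Bool)} (hu : AF j u u') (he : (vPhi n i x : ℤ) ≤ aEps j u) :
    AF j (vl n x ++ u) (vl n x ++ u') := by
  have hu0 := aEps_nonneg j u
  rcases x_cases n x with c | c | c | c
  · rw [vl_pos c]
    refine AF.there _ _ _ ?_ (AF.there _ _ _ ?_ hu) <;>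
      simp only [List.cons_append, List.nil_append, List.append_eq, aEps, vPhi, aH_t, aH_f] at * <;>
      generalize aEps j u = e at * <;>
      rcases hj with rfl | rfl <;> rcases hi.lt_or_eq with hi | rfl <;>
      simp only [hi, if_true, lt_irrefl, if_false] at he <;> split_ifs at * <;> omega
  · subst c; rw [vl_zero]
    refine AF.there _ _ _ ?_ (AF.there _ _ _ ?_ hu) <;>
      simp only [List.cons_append, List.nil_append, List.append_eq, aEps, vPhi, aH_t, aH_f] at * <;>
      generalize aEps j u = e at * <;>
      rcases hj with rfl | rfl <;> rcases hi.lt_or_eq with hi | rfl <;>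
      simp only [hi, if_true, lt_irrefl, if_false] at he <;> split_ifs at * <;> omega
  · rw [vl_neg c]
    refine AF.there _ _ _ ?_ (AF.there _ _ _ ?_ hu) <;>
      simp only [List.cons_append, List.nil_append, List.append_eq, aEps, vPhi, aH_t, aH_f] at * <;>
      generalize aEps j u = e at * <;>
      rcases hj with rfl | rfl <;> rcases hi.lt_or_eq with hi | rfl <;>
      simp only [hi, if_true, lt_irrefl, if_false] at he <;> split_ifs at * <;> omega
  · rw [vl_out c]; exact hu

theorem AF.here' {j : ℤ} {y y' u} (h : aH j y = 1) (hu : aEps j u = 0) (hy : y' = aFl j y) :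
    AF j (y :: u) (y' :: u) := hy ▸ AF.here y u h hu

theorem AF_far2 {j : ℤ} {y u} (h : aH j y = 0) (hu : aEps j u = 0) : aEps j (y :: u) = 0 := by
  simp [aEps, h, hu]

theorem virt_step_lt {n i : ℕ} (h1 : 1 ≤ i) (hi : i < n) : ∀ {w w' : List ℤ}, wF n i w = some w' →
    ∃ Z, AF i (virt n w) Z ∧ AF (2 * n - i) Z (virt n w') := by
  intro w
  induction w with
  | nil => intro w' h; simp [wF] at h
  | cons x w ih =>
    intro w' h
    have E1 := virt_eps h1 hi.le (j := (i : ℤ)) (Or.inl rfl) w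
    have E2 := virt_eps h1 hi.le (j := 2 * (n : ℤ) - i) (Or.inr rfl) w
    simp only [wF] at h
    split_ifs at h with c
    · simp only [Option.map_eq_some_iff, vF, hi, if_true] at h
      simp only [vPhi, hi, if_true] at c
      obtain ⟨x', hx, rfl⟩ := h
      have ew : wEps n i w = 0 := by split_ifs at c <;> omega
      rw [ew] at E1 E2
      simp only [Nat.cast_zero] at E1 E2
      simp only [virt]
      by_cases cx : x = i
      · simp only [cx, if_true, Option.some.injEq] at hx
        subst cx; subst hx
        rw [vl, if_pos (by omega), vl, if_pos (by omega)]
        simp only [List.cons_append, List.nil_append]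
        refine ⟨((i : ℤ) + 1, true) :: (2 * n + 1 - (i : ℤ), false) :: virt n w, ?_, ?_⟩
        · refine AF.here' (by simp [aH]) (AF_far2 ?_ E1) (by simp [aFl])
          rw [aH_f, if_neg (by omega), if_neg (by omega), sub_zero]
        · refine AF.there _ _ _ ?_ (AF.here' ?_ E2 ?_)
          · have : aH (2 * n - i) ((i : ℤ) + 1, true) = 0 := by
              simp only [aH]
              rw [if_neg (show ¬ ((i : ℤ) + 1 = 2 * n - i) by omega),
                if_neg (show ¬ ((i : ℤ) + 1 = 2 * n - i + 1) by omega)]; simp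
            rw [this]; simpa using aEps_nonneg _ _
          · simp only [aH]
            rw [if_neg (show ¬ (2 * (n : ℤ) + 1 - i = 2 * n - i) by omega),
                if_pos (show (2 * (n : ℤ) + 1 - i = 2 * n - i + 1) by omega)]; simp
          · simp only [aFl]; simp <;> ring
      · rw [if_neg cx] at hx
        by_cases cx2 : x = -((i : ℤ) + 1)
        · simp only [cx2, if_true, Option.some.injEq] at hx
          subst cx2; subst hx
          rw [vl, if_neg (by omega), if_neg (by omega), if_pos (by omega), vl, if_neg (by omega),
            if_neg (by omega), if_pos (by omega)]
          simp only [List.cons_append, List.nil_append]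
          refine ⟨(2 * n + 1 + -((i : ℤ) + 1), true) :: ((i : ℤ), false) :: virt n w, ?_, ?_⟩
          · refine AF.there _ _ _ ?_ (AF.here' ?_ E1 ?_)
            · have : aH i (2 * n + 1 + -((i : ℤ) + 1), true) = 0 := by
                simp only [aH]
                rw [if_neg (show ¬ (2 * n + 1 + -((i : ℤ) + 1) = i) by omega),
                  if_neg (show ¬ (2 * n + 1 + -((i : ℤ) + 1) = i + 1) by omega)]; simp
              rw [this]; simpa using aEps_nonneg _ _
            · simp [aH]
            · simp [aFl]
          · rw [neg_neg]
            refine AF.here' ?_ (AF_far2 ?_ E2) ?_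
            · simp only [aH]
              rw [if_pos (show (2 * n + 1 + -((i : ℤ) + 1) = 2 * n - i) by omega),
                if_neg (show ¬ (2 * n + 1 + -((i : ℤ) + 1) = 2 * n - i + 1) by omega)]; simp
            · simp only [aH]
              rw [if_neg (show ¬ ((i : ℤ) = 2 * n - i) by omega),
                if_neg (show ¬ ((i : ℤ) = 2 * n - i + 1) by omega)]; simp
            · simp only [aFl]; simp; ring
        · rw [if_neg cx2] at hx; simp at hx
    · simp only [Option.map_eq_some_iff] at h
      obtain ⟨u, hu, rfl⟩ := h
      obtain ⟨Z, hZ1, hZ2⟩ := ih hu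
      have E3 : aEps (2 * n - i) Z = aEps (2 * n - i) (virt n w) := AF_far (by omega) hZ1
      refine ⟨vl n x ++ Z, AF_vl h1 hi.le (Or.inl rfl) x hZ1 ?_,
        AF_vl h1 hi.le (Or.inr rfl) x hZ2 ?_⟩
      · rw [E1]; omega
      · rw [E3, E2]; omega

theorem virt_step_n {n : ℕ} (h1 : 1 ≤ n) : ∀ {w w' : List ℤ}, wF n n w = some w' →
    AF n (virt n w) (virt n w') := by
  intro w
  induction w with
  | nil => intro w' h; simp [wF] at h
  | cons x w ih =>
    intro w' h
    have E1 := virt_eps h1 le_rfl (j := (n : ℤ)) (Or.inl rfl) w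
    simp only [wF] at h
    split_ifs at h with c
    · simp only [Option.map_eq_some_iff, vF, lt_irrefl, if_false] at h
      simp only [vPhi, lt_irrefl, if_false] at c
      obtain ⟨x', hx, rfl⟩ := h
      simp only [virt]
      by_cases cx : x = n
      · simp only [cx, if_true, Option.some.injEq] at hx c
        subst cx; subst hx
        rw [vl, if_pos (by omega), vl, if_neg (by omega), if_pos rfl]
        simp only [List.cons_append, List.nil_append]
        rw [show 2 * (n : ℤ) + 1 - n = n + 1 by ring]
        refine AF.here' (by simp [aH]) ?_ (by simp [aFl])
        simp [aEps, aH]; omega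
      · rw [if_neg cx] at hx c
        by_cases cx2 : x = 0
        · simp only [cx2, if_true, Option.some.injEq] at hx c
          subst cx2; subst hx
          rw [vl, if_neg (by omega), if_pos rfl, vl, if_neg (by omega), if_neg (by omega),
            if_pos (by omega)]
          simp only [List.cons_append, List.nil_append]
          rw [show 2 * (n : ℤ) + 1 + -n = n + 1 by ring, neg_neg]
          refine AF.there _ _ _ ?_ (AF.here' (by simp [aH]) (by omega) (by simp [aFl]))
          simp [aH, aEps_nonneg]
        · rw [if_neg cx2] at hx; simp at hx
    · simp only [Option.map_eq_some_iff] at h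
      obtain ⟨u, hu, rfl⟩ := h
      exact AF_vl h1 le_rfl (Or.inl rfl) x (ih hu) (by rw [E1]; omega)

theorem Conn_Ch {n : ℕ} {w w' : List ℤ} (h : Conn n w w') (k M : ℤ) :
    Ch (2 * n) k 0 (virt n w) M ↔ Ch (2 * n) k 0 (virt n w') M := by
  induction h with
  | rel a b h =>
    obtain ⟨i, h1, h2, h⟩ := h
    rcases h2.lt_or_eq with h2 | rfl
    · obtain ⟨Z, hZ1, hZ2⟩ := virt_step_lt h1 h2 h
      exact (Ch_iff (by omega) (by omega) hZ1 M).trans (Ch_iff (by omega) (by omega) hZ2 M)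
    · exact Ch_iff (by omega) (by omega) (virt_step_n h1 h) M
  | refl => rfl
  | symm _ _ _ ih => exact ih.symm
  | trans _ _ _ _ _ ih1 ih2 => exact ih1.trans ih2

/-- Pairing of a letter with `ε_1 + ⋯ + ε_k`. -/
def chi (k : ℤ) (x : ℤ) : ℤ := if 1 ≤ x ∧ x ≤ k then 1 else if -k ≤ x ∧ x ≤ -1 then -1 else 0

theorem vl_chi {n : ℕ} {k : ℤ} (hk : 0 ≤ k) (hkn : k ≤ n) (x : ℤ) :
    prs (topP (2 * n) k) (vl n x) = chi k x := by
  unfold vl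
  split_ifs <;> simp [prs, pr, chi, topP] <;> split_ifs <;> omega

theorem virt_chi {n : ℕ} {k : ℤ} (hk : 0 ≤ k) (hkn : k ≤ n) (w : List ℤ) :
    prs (topP (2 * n) k) (virt n w) = (w.map (chi k)).sum := by
  induction w with
  | nil => simp [virt, prs]
  | cons x w ih =>
    have := vl_chi hk hkn x
    simp only [virt, prs, List.map_append, List.sum_append, List.map_cons, List.sum_cons] at *
    rw [ih, this]

theorem virt_mem {n : ℕ} (hn : 1 ≤ n) (w : List ℤ) : ∀ y ∈ virt n w, 1 ≤ y.1 ∧ y.1 ≤ 2 * (n : ℤ) := by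
  induction w with
  | nil => simp [virt]
  | cons x w ih =>
    intro y hy
    rw [virt, List.mem_append] at hy
    rcases hy with hy | hy
    · unfold vl at hy
      split_ifs at hy <;> simp at hy <;> rcases hy with rfl | rfl <;> simp <;> omega
    · exact ih y hy

theorem chi_le {n : ℕ} (hn : 1 ≤ n) {w v : List ℤ} (h : Conn n w v)
    (hw : ∀ i, 1 ≤ i → i ≤ n → wEps n i w = 0) {k : ℤ} (hk : 0 ≤ k) (hkn : k ≤ n) :
    (v.map (chi k)).sum ≤ (w.map (chi k)).sum := by
  rw [← virt_chi hk hkn v, ← virt_chi hk hkn w]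
  apply Ch_hw hk (by omega) (virt_mem hn w)
  · intro j h0 hj
    by_cases c : j ≤ n
    · rw [virt_eps (i := j.toNat) (by omega) (by omega) (Or.inl (by omega)), hw _ (by omega) (by omega)]
      rfl
    · rw [virt_eps (i := (2 * n - j).toNat) (by omega) (by omega) (Or.inr (by omega)),
        hw _ (by omega) (by omega)]
      rfl
  · rw [Conn_Ch h]
    refine Ch_mono (Ch_const (Ad_topP hk (by omega)) _) ?_ le_rfl
    intro t
    simp only [topP, Pi.zero_apply]; split_ifs <;> omega

/-! ### Columns -/

/-- The canonical column. -/
def colw (h : ℕ) : List ℤ := (List.range h).map fun j : ℕ => (j : ℤ) + 1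

/-- The column relation. -/
def RB (n : ℕ) (a b : ℤ) : Prop := rankB n a < rankB n b ∨ (a = 0 ∧ b = 0)

theorem RB_trans {n : ℕ} {a b c : ℤ} (h1 : RB n a b) (h2 : RB n b c) : RB n a c := by
  unfold RB at *
  rcases h1 with h1 | ⟨rfl, rfl⟩
  · rcases h2 with h2 | ⟨rfl, rfl⟩
    · left; omega
    · left; exact h1
  · exact h2

theorem col_pairwise {n : ℕ} {C : List ℤ} (h : IsColB n C) : C.Pairwise (RB n) := by
  haveI : Trans (RB n) (RB n) (RB n) := ⟨RB_trans⟩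
  exact List.isChain_iff_pairwise.mp h.2

theorem colw_pairwise (h : ℕ) : (colw h).Pairwise (· < ·) := by
  rw [colw, List.pairwise_map]
  refine List.pairwise_lt_range.imp ?_
  intro a b hab; omega

theorem mem_colw {h : ℕ} {x : ℤ} : x ∈ colw h ↔ 1 ≤ x ∧ x ≤ h := by
  simp only [colw, List.mem_map, List.mem_range]
  constructor
  · rintro ⟨a, ha, rfl⟩; omega
  · intro hx; exact ⟨(x - 1).toNat, by omega, by omega⟩

theorem length_colw (h : ℕ) : (colw h).length = h := by simp [colw]

theorem col_canon {n : ℕ} {C : List ℤ} (h : C.Pairwise (RB n)) {m : ℕ}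
    (hC : ∀ x ∈ C, 1 ≤ x ∧ x ≤ m) (hm : C.length = m) :
    C = colw m := by
  have hp : C.Pairwise (· < ·) := by
    refine h.imp_of_mem ?_
    intro a b ha hb hab
    have h1 := hC a ha; have h2 := hC b hb
    unfold RB rankB at hab
    rw [if_pos (by omega), if_pos (by omega)] at hab
    omega
  have hn : C.Nodup := hp.imp (fun h => ne_of_lt h)
  have hperm : C.Perm (colw m) := by
    refine (List.subperm_of_subset hn ?_).perm_of_length_le (by rw [length_colw, hm])
    intro x hx; exact mem_colw.mpr (hC x hx)
  exact hperm.eq_of_pairwise (fun a b _ _ h1 h2 => absurd h1 (by omega)) hp (colw_pairwise _)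

theorem chi_le_one (k x : ℤ) : chi k x ≤ 1 := by unfold chi; split_ifs <;> omega

theorem chi_sum_le_aux {n : ℕ} {k : ℤ} {C : List ℤ} (h : C.Pairwise (RB n)) :
    ∀ m : ℤ, 0 ≤ m → (∀ x ∈ C, 0 < x → m < x) → (C.map (chi k)).sum ≤ max 0 (k - m) := by
  induction C with
  | nil => intro m _ _; simp
  | cons x C ih =>
    intro m hm hC
    rw [List.pairwise_cons] at h
    simp only [List.map_cons, List.sum_cons]
    by_cases c : 1 ≤ x ∧ x ≤ k
    · have h1 := hC x (by simp) (by omega)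
      have := ih h.2 x (by omega) (by
        intro y hy hy0
        have := h.1 y hy
        unfold RB rankB at this
        rw [if_pos (by omega), if_pos hy0] at this
        omega)
      have e : chi k x = 1 := by rw [chi, if_pos c]
      omega
    · have := ih h.2 m hm (fun y hy => hC y (by simp [hy]))
      have e : chi k x ≤ 0 := by unfold chi; split_ifs <;> omega
      omega

theorem chi_sum_le {n : ℕ} {k : ℤ} {C : List ℤ} (h : C.Pairwise (RB n)) (hk : 0 ≤ k) :
    (C.map (chi k)).sum ≤ k := by
  have := chi_sum_le_aux (k := k) h 0 le_rfl (fun x _ h => h)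
  omega

theorem chi_sum_le_length (k : ℤ) (C : List ℤ) : (C.map (chi k)).sum ≤ C.length := by
  induction C with
  | nil => simp
  | cons x C ih => have := chi_le_one k x; simp; omega

theorem chi_sum_eq {k : ℤ} {C : List ℤ} (h : (C.map (chi k)).sum = C.length) :
    ∀ x ∈ C, 1 ≤ x ∧ x ≤ k := by
  induction C with
  | nil => simp
  | cons x C ih =>
    have h1 := chi_le_one k x
    have h2 := chi_sum_le_length k C
    simp only [List.map_cons, List.sum_cons, List.length_cons, Nat.cast_add, Nat.cast_one] at h
    have hx : chi k x = 1 := by omega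
    intro y hy
    rcases List.mem_cons.mp hy with rfl | hy
    · unfold chi at hx; split_ifs at hx with c c' <;> first | exact c | omega
    · exact ih (by omega) y hy

theorem chi_colw (k : ℤ) (hk : 0 ≤ k) (h : ℕ) : ((colw h).map (chi k)).sum = min (h : ℤ) k := by
  induction h with
  | zero => simp [colw, hk]
  | succ h ih =>
    have : colw (h + 1) = colw h ++ [(h : ℤ) + 1] := by simp [colw, List.range_succ]
    rw [this, List.map_append, List.sum_append, ih]
    simp only [List.map_cons, List.map_nil, List.sum_cons, List.sum_nil, chi]
    push_cast
    split_ifs <;> omega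

theorem readT_cons (C : List ℤ) (T) : readT (C :: T) = readT T ++ C := by
  simp [readT]

theorem canonWord_cons (h : ℕ) (hs) : canonWord (h :: hs) = canonWord hs ++ colw h := by
  simp only [canonWord, colw, List.map_cons, List.reverse_cons, List.flatten_append,
    List.flatten_cons, List.flatten_nil, List.append_nil, List.append_cancel_left_eq,
    List.bind_eq_flatMap, List.pure_def, ← List.map_eq_flatMap, List.map_map]
  rfl

theorem readT_chi (k : ℤ) (T : List (List ℤ)) :
    ((readT T).map (chi k)).sum = (T.map fun C => (C.map (chi k)).sum).sum := by
  induction T with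
  | nil => simp [readT]
  | cons C T ih =>
    rw [readT_cons, List.map_append, List.sum_append, ih]; simp [add_comm]

theorem canon_chi (k : ℤ) (hk : 0 ≤ k) (T : List (List ℤ)) :
    ((canonWord (T.map List.length)).map (chi k)).sum
      = (T.map fun C => min (C.length : ℤ) k).sum := by
  induction T with
  | nil => simp [canonWord]
  | cons C T ih =>
    rw [List.map_cons, canonWord_cons, List.map_append, List.sum_append, ih, chi_colw k hk]
    simp [add_comm]

theorem sum_termwise {α : Type*} (f g : α → ℤ) (T : List α) (h : ∀ C ∈ T, f C ≤ g C)
    (hs : (T.map g).sum ≤ (T.map f).sum) : ∀ C ∈ T, f C = g C := by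
  induction T with
  | nil => simp
  | cons C T ih =>
    have h1 := h C (by simp)
    have h3 := fun D (hD : D ∈ T) => h D (by simp [hD])
    have h2 : (T.map f).sum ≤ (T.map g).sum := List.sum_le_sum h3
    simp only [List.map_cons, List.sum_cons] at hs
    intro D hD
    rcases List.mem_cons.mp hD with rfl | hD
    · omega
    · exact ih h3 (by omega) D hD

/-- An orthogonal tableau with highest weight reading is canonical. -/
theorem orth_canon {n : ℕ} {T : List (List ℤ)} (hT : IsOrthTabB n T)
    (hlen : ∀ C ∈ T, C.length ≤ n) (hw : ∀ i, 1 ≤ i → i ≤ n → wEps n i (readT T) = 0) :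
    ∀ C ∈ T, C = colw C.length := by
  intro C hC
  have hne : C ≠ [] := (hT.1.1 C hC).2
  have hl : 1 ≤ C.length := List.length_pos_iff.mpr hne
  have hn := hlen C hC
  have h := chi_le (by omega) hT.2 hw (k := (C.length : ℤ)) (by omega) (by omega)
  rw [canon_chi _ (by omega), readT_chi] at h
  have := sum_termwise (fun D : List ℤ => (D.map (chi C.length)).sum)
    (fun D => min (D.length : ℤ) C.length) T (fun D hD => le_min (chi_sum_le_length _ _)
      (chi_sum_le (col_pairwise (hT.1.1 D hD).1) (by omega))) h C hC
  simp only [min_self] at this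
  exact col_canon (col_pairwise (hT.1.1 C hC).1) (chi_sum_eq this) rfl

theorem hw_eps {n i : ℕ} : ∀ {w : List ℤ}, wE n i w = none → wEps n i w = 0 := by
  intro w
  induction w with
  | nil => simp [wEps]
  | cons x w ih =>
    intro h
    simp only [wE] at h
    simp only [wEps]
    split_ifs at h ⊢ with c
    · rw [Option.map_eq_none_iff] at h
      have := ih h; omega
    · rw [Option.map_eq_none_iff] at h
      unfold vE at h
      unfold vEps
      split_ifs at h ⊢ <;> simp_all

theorem wEps_append (n i : ℕ) (u v : List ℤ) :
    (wEps n i (u ++ v) : ℤ) = max (wEps n i u : ℤ) (wEps n i v - (u.map (zh n i)).sum) := by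
  induction u with
  | nil => simp [wEps]
  | cons x u ih =>
    simp only [List.cons_append, wEps_cons, ih, List.map_cons, List.sum_cons]
    omega

/-! ### `ε_i` of columns -/

theorem count_tail {n : ℕ} {x v : ℤ} {C : List ℤ} (h : ∀ b ∈ C, RB n x b) (hv : ¬ RB n x v) :
    C.count v = 0 := List.count_eq_zero.mpr fun hm => hv (h v hm)

theorem count_le_one {n : ℕ} {v : ℤ} (hv : v ≠ 0) {C : List ℤ} (h : C.Pairwise (RB n)) :
    C.count v ≤ 1 := by
  induction C with
  | nil => simp
  | cons x C ih =>
    rw [List.pairwise_cons] at h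
    rw [List.count_cons]
    by_cases c : x = v
    · subst c
      rw [count_tail h.1 (by unfold RB; omega)]; simp
    · have := ih h.2; simp [c]; omega

theorem not_RB {n : ℕ} {x v : ℤ} (h : rankB n v ≤ rankB n x) (h0 : x ≠ 0 ∨ v ≠ 0) :
    ¬ RB n x v := by unfold RB; omega

theorem eps_col_lt {n i : ℕ} (h1 : 1 ≤ i) (hi : i < n) {C : List ℤ} (h : C.Pairwise (RB n)) :
    (wEps n i C : ℤ) = max 0 (max ((C.count ((i : ℤ) + 1) : ℤ) - C.count (i : ℤ))
      ((C.count ((i : ℤ) + 1) : ℤ) - C.count (i : ℤ) + C.count (-(i : ℤ))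
        - C.count (-((i : ℤ) + 1)))) := by
  induction C with
  | nil => simp [wEps]
  | cons x C ih =>
    rw [List.pairwise_cons] at h
    have ih := ih h.2
    have r1 : rankB n i = i := by rw [rankB, if_pos (by omega)]
    have r2 : rankB n (i + 1) = i + 1 := by rw [rankB, if_pos (by omega)]
    have r3 : rankB n (-(i + 1)) = 2 * n + 2 - (i + 1) := by
      rw [rankB, if_neg (by omega), if_neg (by omega)]; ring
    have r4 : rankB n (-i) = 2 * n + 2 - i := by
      rw [rankB, if_neg (by omega), if_neg (by omega)]; ring
    simp only [wEps_cons, List.count_cons, zh, vPhi, vEps, hi, if_true, beq_iff_eq]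
    by_cases c1 : x = i
    · subst c1
      have k1 := count_tail h.1 (not_RB (v := i) (by omega) (by omega))
      simp only [if_true, true_or, if_neg (show ¬ ((i : ℤ) = i + 1) by omega),
        if_neg (show ¬ ((i : ℤ) = -(i + 1)) by omega), if_neg (show ¬ ((i : ℤ) = -i) by omega),
        if_neg (show ¬ ((i : ℤ) = i + 1 ∨ (i : ℤ) = - i) by omega)]
      push_cast; omega
    by_cases c2 : x = i + 1
    · subst c2
      have k1 := count_tail h.1 (not_RB (v := i) (by omega) (by omega))
      have k2 := count_tail h.1 (not_RB (v := i + 1) (by omega) (by omega))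
      simp only [if_true, true_or, if_neg c1,
        if_neg (show ¬ ((i : ℤ) + 1 = -(i + 1)) by omega), if_neg (show ¬ ((i : ℤ) + 1 = -i) by omega),
        if_neg (show ¬ ((i : ℤ) + 1 = i ∨ (i : ℤ) + 1 = - (i + 1)) by omega)]
      push_cast; omega
    by_cases c3 : x = -(i + 1)
    · subst c3
      have k1 := count_tail h.1 (not_RB (v := i) (by omega) (by omega))
      have k2 := count_tail h.1 (not_RB (v := i + 1) (by omega) (by omega))
      have k3 := count_tail h.1 (not_RB (v := -(i + 1)) (by omega) (by omega))
      simp only [if_true, or_true, if_neg c1, if_neg c2,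
        if_neg (show ¬ (-((i : ℤ) + 1) = -i) by omega),
        if_neg (show ¬ (-((i : ℤ) + 1) = i + 1 ∨ -((i : ℤ) + 1) = - i) by omega)]
      push_cast; omega
    by_cases c4 : x = -i
    · subst c4
      have k1 := count_tail h.1 (not_RB (v := i) (by omega) (by omega))
      have k2 := count_tail h.1 (not_RB (v := i + 1) (by omega) (by omega))
      have k3 := count_tail h.1 (not_RB (v := -(i + 1)) (by omega) (by omega))
      have k4 := count_tail h.1 (not_RB (v := -i) (by omega) (by omega))
      simp only [if_true, or_true, if_neg c1, if_neg c2, if_neg c3,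
        if_neg (show ¬ (-(i : ℤ) = i ∨ -(i : ℤ) = - (i + 1)) by omega)]
      push_cast; omega
    simp only [c1, c2, c3, c4, or_self, if_false]
    push_cast; omega

theorem zh_col_lt {n i : ℕ} (h1 : 1 ≤ i) (hi : i < n) (C : List ℤ) :
    (C.map (zh n i)).sum = (C.count (i : ℤ) : ℤ) - C.count ((i : ℤ) + 1)
      + C.count (-((i : ℤ) + 1)) - C.count (-(i : ℤ)) := by
  induction C with
  | nil => simp
  | cons x C ih =>
    simp only [List.map_cons, List.sum_cons, List.count_cons, zh, vPhi, vEps, hi, if_true,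
      beq_iff_eq, ih]
    push_cast
    split_ifs <;> omega

theorem eps_col_n {n : ℕ} (h1 : 1 ≤ n) {C : List ℤ} (h : C.Pairwise (RB n)) :
    (wEps n n C : ℤ) = max 0 (max (if 0 < C.count 0 then 1 - 2 * (C.count (n : ℤ) : ℤ) else 0)
      (2 * (C.count (-(n : ℤ)) : ℤ) - 2 * C.count (n : ℤ))) := by
  induction C with
  | nil => simp [wEps]
  | cons x C ih =>
    rw [List.pairwise_cons] at h
    have ih := ih h.2
    have r1 : rankB n n = n := by rw [rankB, if_pos (by omega)]
    have r2 : rankB n 0 = n + 1 := by simp [rankB]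
    have r4 : rankB n (-n) = 2 * n + 2 - n := by
      rw [rankB, if_neg (by omega), if_neg (by omega)]; ring
    simp only [wEps_cons, List.count_cons, zh, vPhi, vEps, lt_irrefl, if_false, beq_iff_eq]
    by_cases c1 : x = n
    · subst c1
      have k1 := count_tail h.1 (not_RB (v := n) (by omega) (by omega))
      simp only [if_true, if_neg (show ¬ ((n : ℤ) = 0) by omega),
        if_neg (show ¬ ((n : ℤ) = -n) by omega)]
      push_cast; split_ifs at * <;> omega
    by_cases c2 : x = 0
    · subst c2
      have k1 := count_tail h.1 (not_RB (v := n) (by omega) (by omega))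
      simp only [if_true, if_neg c1, if_neg (show ¬ ((0 : ℤ) = -n) by omega)]
      push_cast; split_ifs at * <;> omega
    by_cases c3 : x = -n
    · subst c3
      have k1 := count_tail h.1 (not_RB (v := n) (by omega) (by omega))
      have k2 := count_tail h.1 (not_RB (v := 0) (by omega) (by omega))
      have k3 := count_tail h.1 (not_RB (v := -n) (by omega) (by omega))
      simp only [if_true, if_neg c1, if_neg c2]
      push_cast; split_ifs at * <;> omega
    simp only [c1, c2, c3, if_false]
    push_cast; split_ifs at * <;> omega

theorem zh_col_n {n : ℕ} (h1 : 1 ≤ n) (C : List ℤ) :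
    (C.map (zh n n)).sum = 2 * (C.count (n : ℤ) : ℤ) - 2 * C.count (-(n : ℤ)) := by
  induction C with
  | nil => simp
  | cons x C ih =>
    simp only [List.map_cons, List.sum_cons, List.count_cons, zh, vPhi, vEps, lt_irrefl, if_false,
      beq_iff_eq, ih]
    push_cast
    split_ifs <;> omega

/-! ### Splitting -/

/-- The paired letters of a column, in decreasing order. -/
def pairsC (n : ℕ) (C : List ℤ) : List ℤ :=
  ((List.range n).reverse.map fun k : ℕ => (k : ℤ)).filterMap fun k : ℤ =>
      if (k + 1 ∈ C ∧ -(k + 1) ∈ C) then some (k + 1) else none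

theorem IC_eq (n : ℕ) (C : List ℤ) :
    IC n C = List.replicate (C.count 0) 0 ++ pairsC n C := by
  simp only [IC, pairsC, List.bind_eq_flatMap, List.pure_def, ← List.map_eq_flatMap]

theorem mem_pairsC {n : ℕ} {C : List ℤ} {z : ℤ} :
    z ∈ pairsC n C ↔ 1 ≤ z ∧ z ≤ n ∧ z ∈ C ∧ -z ∈ C := by
  simp only [pairsC, List.mem_filterMap, List.mem_map, List.mem_reverse, List.mem_range]
  constructor
  · rintro ⟨k, ⟨m, hm, rfl⟩, hk⟩
    split_ifs at hk with c
    simp only [Option.some.injEq] at hk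
    subst hk
    exact ⟨by omega, by omega, c.1, c.2⟩
  · rintro ⟨h1, h2, h3, h4⟩
    refine ⟨z - 1, ⟨(z - 1).toNat, by omega, by omega⟩, ?_⟩
    rw [show z - 1 + 1 = z by ring, if_pos ⟨h3, h4⟩]

theorem pairsC_pairwise (n : ℕ) (C : List ℤ) : (pairsC n C).Pairwise (fun a b => b < a) := by
  unfold pairsC
  rw [List.pairwise_filterMap, List.pairwise_map, List.pairwise_reverse]
  refine List.pairwise_lt_range.imp ?_
  intro a b hab x hx y hy
  split_ifs at hx hy
  simp only [Option.some.injEq] at hx hy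
  omega

/-- The order on `I_C`. -/
def SI (a b : ℤ) : Prop := a = 0 ∨ (0 < b ∧ b ≤ a)

theorem IC_pairwise (n : ℕ) (C : List ℤ) : (IC n C).Pairwise SI := by
  rw [IC_eq, List.pairwise_append]
  refine ⟨?_, ?_, ?_⟩
  · rw [List.pairwise_replicate]; right; left; rfl
  · refine (pairsC_pairwise n C).imp_of_mem ?_
    intro a b ha hb hab
    have := mem_pairsC.mp hb
    right; omega
  · intro a ha b hb
    left; exact List.eq_of_mem_replicate ha

theorem mem_IC {n : ℕ} {C : List ℤ} {z : ℤ} (h : z ∈ IC n C) :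
    (z = 0 ∧ 0 ∈ C) ∨ (1 ≤ z ∧ z ≤ n ∧ z ∈ C ∧ -z ∈ C) := by
  rw [IC_eq, List.mem_append] at h
  rcases h with h | h
  · rw [List.mem_replicate] at h
    left; exact ⟨h.2, List.count_pos_iff.mp (by omega)⟩
  · right; exact mem_pairsC.mp h

theorem count_desc {J : List ℤ} (h : J.Pairwise (fun a b => b < a)) (v : ℤ) : J.count v ≤ 1 := by
  have hn : J.Nodup := h.imp (fun h => ne_of_gt h)
  exact List.nodup_iff_count_le_one.mp hn v

theorem IC_count_zero (n : ℕ) (C : List ℤ) : (IC n C).count 0 = C.count 0 := by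
  have h0 : (pairsC n C).count 0 = 0 := by
    rw [List.count_eq_zero]
    intro h; have := mem_pairsC.mp h; omega
  rw [IC_eq, List.count_append, List.count_replicate_self, h0, add_zero]

theorem IC_count_neg (n : ℕ) (C : List ℤ) {k : ℤ} (hk : k < 0) : (IC n C).count k = 0 := by
  rw [List.count_eq_zero]
  intro h; rcases mem_IC h with h | h <;> omega

theorem IC_count_le (n : ℕ) (C : List ℤ) {k : ℤ} (hk : 1 ≤ k) : (IC n C).count k ≤ 1 := by
  rw [IC_eq, List.count_append, List.count_replicate]
  have := count_desc (pairsC_pairwise n C) k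
  have : ¬ ((0 : ℤ) = k) := by omega
  simp [this]; omega

theorem IC_count_pos {n : ℕ} {C : List ℤ} {k : ℤ} (hk : 1 ≤ k) (hkn : k ≤ n) :
    0 < (IC n C).count k ↔ 0 < C.count k ∧ 0 < C.count (-k) := by
  simp only [List.count_pos_iff]
  rw [IC_eq, List.mem_append, mem_pairsC, List.mem_replicate]
  constructor
  · rintro (h | h)
    · omega
    · exact h.2.2
  · intro h; right; exact ⟨hk, hkn, h⟩

theorem greedy_basic {n : ℕ} {C : List ℤ} : ∀ {I J : List ℤ} {b : ℤ}, GreedyJ n C I J b →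
    I.length = J.length ∧ J.Pairwise (fun a b => b < a) ∧
      ∀ t ∈ J, 1 ≤ t ∧ t < b ∧ t ∉ C ∧ -t ∉ C
  | [], [], _, _ => by simp
  | z :: I, t :: J, b, h => by
    obtain ⟨⟨h1, h2, h3, h4, h5⟩, h6⟩ := h
    obtain ⟨k1, k2, k3⟩ := greedy_basic h6
    have h7 : t < b := lt_of_lt_of_le h2 (min_le_left _ _)
    refine ⟨by simp [k1], List.pairwise_cons.mpr ⟨fun s hs => (k3 s hs).2.1, k2⟩, ?_⟩
    intro s hs
    rcases List.mem_cons.mp hs with rfl | hs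
    · exact ⟨h1, h7, h3, h4⟩
    · have := k3 s hs; exact ⟨this.1, by omega, this.2.2⟩
  | [], _ :: _, _, h => by simp [GreedyJ] at h
  | _ :: _, [], _, h => by simp [GreedyJ] at h

theorem greedy_mem {n : ℕ} {C : List ℤ} {i : ℤ} (hin : i < n + 1) (hi : 1 ≤ i)
    (hC : i ∉ C) (hC' : -i ∉ C) : ∀ {I J : List ℤ} {b : ℤ}, GreedyJ n C I J b →
    I.Pairwise SI → i < b → i + 1 ∈ I → i ∈ J
  | [], [], _, _ => by simp
  | z :: I, t :: J, b, h => by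
    intro hp hb hm
    obtain ⟨⟨h1, h2, h3, h4, h5⟩, h6⟩ := h
    rw [List.pairwise_cons] at hp
    rcases lt_trichotomy t i with c | c | c
    · exfalso
      have hz : i < (if z = 0 then (n : ℤ) + 1 else z) := by
        split_ifs with c0
        · exact hin
        · rcases List.mem_cons.mp hm with rfl | hm
          · omega
          · rcases hp.1 _ hm with h | h <;> omega
      rcases h5 i c (lt_min hb hz) with h | h
      · exact hC h
      · exact hC' h
    · simp [c]
    · have hne : i + 1 ≠ z := by
        rintro rfl
        have := lt_of_lt_of_le h2 (min_le_right _ _)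
        rw [if_neg (by omega)] at this; omega
      have hm' : i + 1 ∈ I := by
        rcases List.mem_cons.mp hm with h | h
        · exact absurd h hne
        · exact h
      exact List.mem_cons_of_mem _ (greedy_mem hin hi hC hC' h6 hp.2 c hm')
  | [], _ :: _, _, h => by simp [GreedyJ] at h
  | _ :: _, [], _, h => by simp [GreedyJ] at h

theorem greedy_mem_n {n : ℕ} {C J : List ℤ} (hC : (n : ℤ) ∉ C) (hC' : -(n : ℤ) ∉ C)
    (h0 : 0 < C.count 0) (h : GreedyJ n C (IC n C) J ((n : ℤ) + 1)) : (n : ℤ) ∈ J := by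
  rw [IC_eq] at h
  obtain ⟨m, hm⟩ : ∃ m, C.count 0 = m + 1 := ⟨C.count 0 - 1, by omega⟩
  rw [hm, List.replicate_succ, List.cons_append] at h
  match J, h with
  | t :: J, h =>
    obtain ⟨⟨h1, h2, h3, h4, h5⟩, h6⟩ := h
    rw [if_pos rfl, min_self] at h2 h5
    by_cases c : t = n
    · simp [c]
    · exfalso
      rcases h5 n (by omega) (by omega) with h | h
      · exact hC h
      · exact hC' h

theorem count_map_neg (L : List ℤ) (v : ℤ) : (L.map fun z => -z).count v = L.count (-v) := by
  have := List.count_map_of_injective L (fun z : ℤ => -z) neg_injective (-v)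
  simpa using this

structure SplitData (n : ℕ) (C l r J : List ℤ) : Prop where
  greedy : GreedyJ n C (IC n C) J ((n : ℤ) + 1)
  lp : l.Pairwise (RB n)
  rp : r.Pairwise (RB n)
  lc : ∀ v, l.count v + (IC n C).count v = C.count v + J.count v
  rc : ∀ v, r.count v + (IC n C).count (-v) = C.count v + J.count (-v)
  ll : l.length = C.length
  rl : r.length = C.length

theorem chain_pairwise {n : ℕ} {l : List ℤ} (h : l.IsChain (fun a b => rankB n a < rankB n b)) :
    l.Pairwise (RB n) := by
  haveI : Trans (RB n) (RB n) (RB n) := ⟨RB_trans⟩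
  exact List.isChain_iff_pairwise.mp (h.imp fun a b hab => Or.inl hab)

theorem splitData {n : ℕ} {C l r : List ℤ} (h : SplitPair n C l r) :
    ∃ J, SplitData n C l r J := by
  obtain ⟨J, hg, h1, h2, h3, h4⟩ := h
  have hlen := (greedy_basic hg).1
  refine ⟨J, hg, chain_pairwise h1, chain_pairwise h3, ?_, ?_, ?_, ?_⟩
  · intro v
    have := congrArg (Multiset.count v) h2
    simpa only [Multiset.count_add, Multiset.coe_count] using this
  · intro v
    have := congrArg (Multiset.count v) h4
    simpa only [Multiset.count_add, Multiset.coe_count, count_map_neg] using this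
  · have := congrArg Multiset.card h2
    simp only [Multiset.card_add, Multiset.coe_card] at this
    omega
  · have := congrArg Multiset.card h4
    simp only [Multiset.card_add, Multiset.coe_card, List.length_map] at this
    omega

/-- Count statistics of a split pair at one letter. -/
theorem split_counts {n : ℕ} {C l r J : List ℤ} (hC : C.Pairwise (RB n))
    (h : SplitData n C l r J) {k : ℤ} (hk : 1 ≤ k) (hkn : k ≤ n) :
    l.count k + (IC n C).count k = C.count k + J.count k ∧ l.count (-k) = C.count (-k) ∧
    r.count k = C.count k ∧ r.count (-k) + (IC n C).count k = C.count (-k) + J.count k ∧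
    C.count k ≤ 1 ∧ C.count (-k) ≤ 1 ∧ J.count k ≤ 1 ∧ (IC n C).count k ≤ 1 ∧
    (0 < (IC n C).count k ↔ 0 < C.count k ∧ 0 < C.count (-k)) ∧
    (0 < J.count k → C.count k = 0 ∧ C.count (-k) = 0) := by
  obtain ⟨b1, b2, b3⟩ := greedy_basic h.greedy
  have a1 := h.lc k
  have a2 := h.lc (-k)
  have a3 := h.rc k
  have a4 := h.rc (-k)
  rw [neg_neg] at a4
  have i1 := IC_count_neg n C (k := -k) (by omega)
  have j1 : J.count (-k) = 0 := by
    rw [List.count_eq_zero]; intro hm; have := (b3 _ hm).1; omega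
  refine ⟨a1, by omega, by omega, a4, count_le_one (by omega) hC, count_le_one (by omega) hC,
    count_desc b2 k, IC_count_le n C hk, IC_count_pos hk hkn, ?_⟩
  intro hp
  have := b3 k (List.count_pos_iff.mp hp)
  exact ⟨List.count_eq_zero.mpr this.2.2.1, List.count_eq_zero.mpr this.2.2.2⟩

theorem split_zero {n : ℕ} {C l r J : List ℤ} (h : SplitData n C l r J) :
    l.count 0 = 0 ∧ r.count 0 = 0 := by
  obtain ⟨b1, b2, b3⟩ := greedy_basic h.greedy
  have a1 := h.lc 0
  have a2 := h.rc 0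
  rw [neg_zero] at a2
  have i1 := IC_count_zero n C
  have j1 : J.count 0 = 0 := by
    rw [List.count_eq_zero]; intro hm; have := (b3 _ hm).1; omega
  omega

theorem split_eps {n : ℕ} {C l r : List ℤ} (hC : C.Pairwise (RB n))
    (h : SplitPair n C l r) {i : ℕ} (hi : 1 ≤ i) (hin : i ≤ n) :
    2 * (wEps n i C : ℤ) ≤ wEps n i (r ++ l) ∧
    ((r ++ l).map (zh n i)).sum = 2 * (C.map (zh n i)).sum := by
  obtain ⟨J, h⟩ := splitData h
  rw [wEps_append, List.map_append, List.sum_append]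
  obtain ⟨p1, p2, p3, p4, p5, p6, p7, p8, p9, p10⟩ :=
    split_counts hC h (k := i) (by omega) (by omega)
  rcases Nat.lt_or_ge i n with c | c
  · obtain ⟨q1, q2, q3, q4, q5, q6, q7, q8, q9, q10⟩ :=
      split_counts hC h (k := (i : ℤ) + 1) (by omega) (by omega)
    have key : 0 < (IC n C).count ((i : ℤ) + 1) → C.count (i : ℤ) = 0 → C.count (-(i : ℤ)) = 0 →
        0 < J.count (i : ℤ) := by
      intro h1 h2 h3
      rw [List.count_pos_iff] at h1 ⊢
      exact greedy_mem (by omega) (by omega) (List.count_eq_zero.mp h2)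
        (List.count_eq_zero.mp h3) h.greedy (IC_pairwise n C) (by omega) h1
    rw [eps_col_lt hi c hC, eps_col_lt hi c h.lp, eps_col_lt hi c h.rp, zh_col_lt hi c,
      zh_col_lt hi c, zh_col_lt hi c]
    generalize (IC n C).count ((i : ℤ) + 1) = A1 at *
    generalize (IC n C).count (i : ℤ) = A2 at *
    generalize J.count ((i : ℤ) + 1) = A3 at *
    generalize J.count (i : ℤ) = A4 at *
    generalize l.count ((i : ℤ) + 1) = A5 at *
    generalize l.count (i : ℤ) = A6 at *
    generalize l.count (-((i : ℤ) + 1)) = A7 at *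
    generalize l.count (-(i : ℤ)) = A8 at *
    generalize r.count ((i : ℤ) + 1) = B5 at *
    generalize r.count (i : ℤ) = B6 at *
    generalize r.count (-((i : ℤ) + 1)) = B7 at *
    generalize r.count (-(i : ℤ)) = B8 at *
    generalize C.count ((i : ℤ) + 1) = C5 at *
    generalize C.count (i : ℤ) = C6 at *
    generalize C.count (-((i : ℤ) + 1)) = C7 at *
    generalize C.count (-(i : ℤ)) = C8 at *
    clear hC h
    interval_cases C5 <;> interval_cases C6 <;> interval_cases C7 <;> interval_cases C8 <;> omega
  · obtain rfl : i = n := by omega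
    obtain ⟨z1, z2⟩ := split_zero h
    have key : 0 < C.count 0 → C.count (i : ℤ) = 0 → C.count (-(i : ℤ)) = 0 →
        0 < J.count (i : ℤ) := by
      intro h1 h2 h3
      rw [List.count_pos_iff]
      exact greedy_mem_n (List.count_eq_zero.mp h2) (List.count_eq_zero.mp h3) h1 h.greedy
    rw [eps_col_n hi hC, eps_col_n hi h.lp, eps_col_n hi h.rp, zh_col_n hi, zh_col_n hi,
      zh_col_n hi, z1, z2]
    simp only [lt_irrefl, if_false]
    split_ifs <;> omega

/-- Inductive description of the split form. -/
inductive Spl (n : ℕ) : List (List ℤ) → List (List ℤ) → Prop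
  | nil : Spl n [] []
  | cons {C l r : List ℤ} {T S : List (List ℤ)} : SplitPair n C l r → Spl n T S →
      Spl n (C :: T) (l :: r :: S)

theorem spl_of {n : ℕ} : ∀ (T L R : List (List ℤ))
    (hL : T.length = L.length) (hR : T.length = R.length)
    (_ : ∀ i : Fin T.length,
      SplitPair n (T.get i) (L.get (Fin.cast hL i)) (R.get (Fin.cast hR i))),
    Spl n T ((List.zip L R).flatMap fun p => [p.1, p.2])
  | [], [], [], _, _, _ => Spl.nil
  | C :: T, l :: L, r :: R, hL, hR, h => by
    refine Spl.cons (h ⟨0, by simp⟩) (spl_of T L R (by simpa using hL) (by simpa using hR) ?_)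
    intro i
    exact h i.succ

theorem spl_eps {n : ℕ} {T S : List (List ℤ)} (h : Spl n T S) (hT : ∀ C ∈ T, IsColB n C)
    {i : ℕ} (hi : 1 ≤ i) (hin : i ≤ n) :
    2 * (wEps n i (readT T) : ℤ) ≤ wEps n i (readT S) ∧
    ((readT S).map (zh n i)).sum = 2 * ((readT T).map (zh n i)).sum := by
  induction h with
  | nil => simp [readT, wEps]
  | @cons C l r T S h1 h2 ih =>
    obtain ⟨k1, k2⟩ := ih (fun C hC => hT C (by simp [hC]))
    obtain ⟨k3, k4⟩ := split_eps (col_pairwise (hT C (by simp))) h1 hi hin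
    rw [readT_cons, readT_cons, readT_cons, List.append_assoc, wEps_append, wEps_append,
      List.map_append, List.sum_append, k4, k2, List.map_append, List.sum_append]
    refine ⟨?_, by ring⟩
    omega

theorem readT_canon {T : List (List ℤ)} (h : ∀ C ∈ T, C = colw C.length) :
    readT T = canonWord (T.map List.length) := by
  induction T with
  | nil => simp [readT, canonWord]
  | cons C T ih =>
    rw [readT_cons, List.map_cons, canonWord_cons, ih (fun D hD => h D (by simp [hD])),
      ← h C (by simp)]

theorem perm_canon {n : ℕ} {C l : List ℤ} (hl : l.Pairwise (RB n))
    (hC : C = colw C.length) (h : ∀ v, l.count v = C.count v) : l = colw l.length := by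
  have hp : l.Perm C := List.perm_iff_count.mpr h
  refine col_canon hl ?_ rfl
  intro x hx
  have := hp.mem_iff.mp hx
  rw [hC, mem_colw] at this
  rw [hp.length_eq]; exact this

theorem split_canon {n : ℕ} {C l r : List ℤ} (h : SplitPair n C l r)
    (hC : C = colw C.length) :
    l = colw l.length ∧ r = colw r.length := by
  obtain ⟨J, h⟩ := splitData h
  have hpos : ∀ x ∈ C, 1 ≤ x := by
    intro x hx; rw [hC, mem_colw] at hx; exact hx.1
  have hI : IC n C = [] := by
    rw [List.eq_nil_iff_forall_not_mem]
    intro z hz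
    rcases mem_IC hz with ⟨_, h0⟩ | ⟨h1, h2, h3, h4⟩
    · have := hpos _ h0; omega
    · have := hpos _ h4; omega
  have hJ : J = [] := by
    have := (greedy_basic h.greedy).1
    rw [hI] at this
    exact List.length_eq_zero_iff.mp this.symm
  have h1 := h.lc
  have h2 := h.rc
  rw [hI, hJ] at h1 h2
  exact ⟨perm_canon h.lp hC (by simpa using h1), perm_canon h.rp hC (by simpa using h2)⟩

theorem unsplit_canon {n : ℕ} {C l r : List ℤ} (hc : IsColB n C) (h : SplitPair n C l r)
    (hl : l = colw l.length) (hr : r = colw r.length) : C = colw C.length := by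
  obtain ⟨J, h⟩ := splitData h
  obtain ⟨b1, b2, b3⟩ := greedy_basic h.greedy
  have hJ : J = [] := by
    rw [List.eq_nil_iff_forall_not_mem]
    intro t ht
    obtain ⟨t1, t2, t3, t4⟩ := b3 t ht
    have e := h.rc (-t)
    rw [neg_neg] at e
    have e1 : r.count (-t) = 0 := by
      rw [List.count_eq_zero]; intro hm; rw [hr, mem_colw] at hm; omega
    have e2 : 0 < J.count t := List.count_pos_iff.mpr ht
    have e3 : 0 < (IC n C).count t := by omega
    rcases mem_IC (List.count_pos_iff.mp e3) with ⟨h0, _⟩ | ⟨h1, h2, h3, h4⟩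
    · omega
    · exact t3 h3
  have hI : IC n C = [] := by
    rw [hJ] at b1
    exact List.length_eq_zero_iff.mp b1
  have h1 := h.lc
  rw [hI, hJ] at h1
  exact perm_canon (col_pairwise hc) hl (fun v => by have := h1 v; simp at this; exact this.symm)

theorem colw_isCol {n m : ℕ} (h : m ≤ n) : IsColB n (colw m) := by
  constructor
  · intro v hv; rw [mem_colw] at hv; omega
  · refine ((colw_pairwise m).imp_of_mem ?_).isChain
    intro a b ha hb hab
    rw [mem_colw] at ha hb
    left
    rw [rankB, rankB, if_pos (by omega), if_pos (by omega)]; exact hab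

theorem spl_canon {n : ℕ} {T S : List (List ℤ)} (h : Spl n T S)
    (hT : ∀ C ∈ T, C = colw C.length) : ∀ C ∈ S, C = colw C.length := by
  induction h with
  | nil => simp
  | @cons C l r T S h1 h2 ih =>
    obtain ⟨k1, k2⟩ := split_canon h1 (hT C (by simp))
    intro D hD
    rcases List.mem_cons.mp hD with rfl | hD
    · exact k1
    rcases List.mem_cons.mp hD with rfl | hD
    · exact k2
    · exact ih (fun C hC => hT C (by simp [hC])) D hD

theorem unspl_canon {n : ℕ} {T S : List (List ℤ)} (h : Spl n T S) (hT : ∀ C ∈ T, IsColB n C)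
    (hS : ∀ C ∈ S, C = colw C.length) : ∀ C ∈ T, C = colw C.length := by
  induction h with
  | nil => simp
  | @cons C l r T S h1 h2 ih =>
    intro D hD
    rcases List.mem_cons.mp hD with rfl | hD
    · exact unsplit_canon (hT _ (by simp)) h1 (hS l (by simp)) (hS r (by simp))
    · exact ih (fun C hC => hT C (by simp [hC])) (fun C hC => hS C (by simp [hC])) D hD

theorem spl_length {n : ℕ} {T S : List (List ℤ)} (h : Spl n T S) :
    S.map List.length = (T.map List.length).flatMap fun m => [m, m] := by
  induction h with
  | nil => simp
  | @cons C l r T S h1 h2 ih =>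
    obtain ⟨J, h⟩ := splitData h1
    simp [ih, h.ll, h.rl]

theorem chain_double : ∀ {L : List ℕ}, L.IsChain (fun a b => b ≤ a) →
    (L.flatMap fun m => [m, m]).IsChain (fun a b => b ≤ a)
  | [], _ => by simp
  | [a], _ => by simp
  | a :: b :: L, h => by
    rw [List.isChain_cons_cons] at h
    have := chain_double h.2
    simp only [List.flatMap_cons, List.cons_append, List.nil_append] at this ⊢
    exact List.isChain_cons_cons.mpr ⟨le_rfl, List.isChain_cons_cons.mpr ⟨h.1, this⟩⟩

theorem spl_mem_length {n : ℕ} {T S : List (List ℤ)} (h : Spl n T S) {D : List ℤ} (hD : D ∈ S) :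
    ∃ C ∈ T, D.length = C.length := by
  have : D.length ∈ S.map List.length := List.mem_map_of_mem hD
  rw [spl_length h] at this
  simp only [List.mem_flatMap, List.mem_map] at this
  obtain ⟨m, ⟨C, hC, rfl⟩, hm⟩ := this
  exact ⟨C, hC, by simpa using hm⟩
/-- Let `T = C₁ ⋯ C_r` be a tabloid of type `B` with
admissible columns and let `spl(T) = (lC₁)(rC₁) ⋯ (lC_r)(rC_r)` be its split
form.  If the reading of `spl(T)` is the highest weight vertex of its
connected crystal component, then `T` is an orthogonal tableau if and only if
`spl(T)` is an orthogonal tableau. -/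
theorem stmt9 (n : ℕ) (T L R : List (List ℤ))
    (htab : IsTabloidB n T)
    (hadm : ∀ C ∈ T, Admissible n C)
    (hL : T.length = L.length) (hR : T.length = R.length)
    (hsplit : ∀ i : Fin T.length,
      SplitPair n (T.get i) (L.get (Fin.cast hL i)) (R.get (Fin.cast hR i)))
    (S : List (List ℤ))
    (hS : S = (List.zip L R).flatMap fun p => [p.1, p.2])
    (hhw : HighestWt n (readT S)) :
    IsOrthTabB n T ↔ IsOrthTabB n S := by
  have hspl : Spl n T S := by rw [hS]; exact spl_of T L R hL hR hsplit
  have hcol : ∀ C ∈ T, IsColB n C := fun C hC => (htab.1 C hC).1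
  have hSw : ∀ i, 1 ≤ i → i ≤ n → wEps n i (readT S) = 0 := fun i h1 h2 => hw_eps (hhw i h1 h2)
  have hTw : ∀ i, 1 ≤ i → i ≤ n → wEps n i (readT T) = 0 := by
    intro i h1 h2
    have := (spl_eps hspl hcol h1 h2).1
    rw [hSw i h1 h2] at this
    omega
  have hSlen : ∀ D ∈ S, D.length ≤ n := by
    intro D hD
    obtain ⟨C, hC, e⟩ := spl_mem_length hspl hD
    rw [e]; exact (hadm C hC).1
  constructor
  · intro hT
    have hc := orth_canon hT (fun C hC => (hadm C hC).1) hTw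
    have hcS := spl_canon hspl hc
    refine ⟨⟨?_, ?_⟩, ?_⟩
    · intro D hD
      obtain ⟨C, hC, e⟩ := spl_mem_length hspl hD
      refine ⟨?_, ?_⟩
      · rw [hcS D hD]; exact colw_isCol (hSlen D hD)
      · have := List.length_pos_iff.mpr (htab.1 C hC).2
        exact List.length_pos_iff.mp (by omega)
    · have h1 : (T.map List.length).IsChain (fun a b => b ≤ a) :=
        (List.isChain_map _).mpr htab.2
      have h2 := chain_double h1
      rw [← spl_length hspl] at h2
      exact (List.isChain_map _).mp h2
    · rw [readT_canon hcS]; exact Relation.EqvGen.refl _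
  · intro hSo
    have hc := orth_canon hSo hSlen hSw
    refine ⟨htab, ?_⟩
    rw [readT_canon (unspl_canon hspl hcol hc)]; exact Relation.EqvGen.refl _
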